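/- arXiv:1909.07022 — 4 statements merged into one kernel-verified Lean document; each statement's English description precedes it below -/
import Mathlib

section
/- Let λ, c ∈ [0,∞) and let w : [0,∞) → [0,∞) be continuous with w(0) = 0. Suppose that for every T ≥ 0 one has w(T)²/2 ≤ λ·∫₀^T w(t)² dt + c·∫₀^T w(t) dt. Then w(t) ≤ 2c·t·e^{2λt} for every t ≥ 0; in particular, w(t) ≤ 2e^{2λ}·c·t for every t ∈ [0,1]. -/
open Set MeasureTheory in
/-- Integral form of Grönwall's inequality for nonnegative functions. -/
theorem le_mul_exp_of_le_add_mul_integral {u : ℝ → ℝ} {K ε b : ℝ} (hK : 0 ≤ K)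
    (hu : ContinuousOn u (Ici 0)) (hu0 : ∀ t, 0 ≤ t → 0 ≤ u t)
    (h : ∀ T ∈ Icc 0 b, u T ≤ K * (∫ t in (0 : ℝ)..T, u t) + ε) :
    ∀ T ∈ Icc 0 b, u T ≤ ε * Real.exp (K * T) := by
  have hint : ∀ x, 0 ≤ x → IntervalIntegrable u volume 0 x := fun x hx =>
    (hu.mono (by rw [uIcc_of_le hx]; exact Icc_subset_Ici_self)).intervalIntegrable
  have hnn : ∀ x, 0 ≤ x → 0 ≤ ∫ t in (0 : ℝ)..x, u t := fun x hx =>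
    intervalIntegral.integral_nonneg hx fun t ht => hu0 t ht.1
  intro T hT
  have hb : 0 ≤ b := hT.1.trans hT.2
  have hF : ContinuousOn (fun x => ∫ t in (0 : ℝ)..x, u t) (Icc 0 b) := by
    have := intervalIntegral.continuousOn_primitive_interval' (hint b hb) left_mem_uIcc
    rwa [uIcc_of_le hb] at this
  have hF' : ∀ x ∈ Ico 0 b,
      HasDerivWithinAt (fun x => ∫ t in (0 : ℝ)..x, u t) (u x) (Ici x) x := fun x hx =>
    have hx' : ContinuousOn u (Ici x) := hu.mono (Ici_subset_Ici.2 hx.1)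
    intervalIntegral.integral_hasDerivWithinAt_right (t := Ioi x) (hint x hx.1)
      ((hx'.mono Ioi_subset_Ici_self).stronglyMeasurableAtFilter_nhdsWithin measurableSet_Ioi x)
      ((hx' x self_mem_Ici).mono Ioi_subset_Ici_self)
  have hG := norm_le_gronwallBound_of_norm_deriv_right_le (δ := 0) (K := K) (ε := ε) hF hF'
    (by simp) (fun x hx => by
      rw [Real.norm_of_nonneg (hu0 x hx.1), Real.norm_of_nonneg (hnn x hx.1)]
      exact h x (Ico_subset_Icc_self hx)) T hT
  rw [Real.norm_of_nonneg (hnn T hT.1), sub_zero] at hG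
  calc u T ≤ K * (∫ t in (0 : ℝ)..T, u t) + ε := h T hT
    _ ≤ K * gronwallBound 0 K ε T + ε := by gcongr
    _ = ε * Real.exp (K * T) := by
      rcases eq_or_ne K 0 with rfl | hK0
      · simp
      · rw [gronwallBound_of_K_ne_0 hK0]
        field_simp
        ring

/-- Let λ, c ∈ [0,∞) and let w : [0,∞) → [0,∞) be continuous with w(0) = 0.
Suppose that for every T ≥ 0 one has w(T)²/2 ≤ λ·∫₀^T w(t)² dt + c·∫₀^T w(t) dt. Then
w(t) ≤ 2c·t·e^{2λt} for every t ≥ 0; in particular, w(t) ≤ 2e^{2λ}·c·t for every t ∈ [0,1]. -/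
theorem stmt2 (lam c : ℝ) (hlam : 0 ≤ lam) (hc : 0 ≤ c) (w : ℝ → ℝ)
    (hwcont : ContinuousOn w (Set.Ici 0)) (hwnn : ∀ t : ℝ, 0 ≤ t → 0 ≤ w t)
    (hw0 : w 0 = 0)
    (hineq : ∀ T : ℝ, 0 ≤ T →
      w T ^ 2 / 2 ≤ lam * (∫ t in (0:ℝ)..T, w t ^ 2) + c * ∫ t in (0:ℝ)..T, w t) :
    (∀ t : ℝ, 0 ≤ t → w t ≤ 2 * c * t * Real.exp (2 * lam * t)) ∧
    (∀ t ∈ Set.Icc (0:ℝ) 1, w t ≤ 2 * Real.exp (2 * lam) * c * t) := by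
  have main : ∀ t : ℝ, 0 ≤ t → w t ≤ 2 * c * t * Real.exp (2 * lam * t) := by
    intro t ht
    obtain ⟨s, hs, hmax⟩ := isCompact_Icc.exists_isMaxOn (Set.nonempty_Icc.2 ht)
      (hwcont.mono Set.Icc_subset_Ici_self)
    have hM : ∀ x ∈ Set.Icc 0 t, w x ≤ w s := fun x hx => hmax hx
    have hM0 : 0 ≤ w s := hwnn s hs.1
    have hint : ∀ T ∈ Set.Icc 0 t, ∫ x in (0 : ℝ)..T, w x ≤ t * w s := by
      intro T hT
      calc ∫ x in (0 : ℝ)..T, w x ≤ ∫ _ in (0 : ℝ)..T, w s := by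
            refine intervalIntegral.integral_mono_on hT.1 ?_ (by simp)
              fun x hx => hM x ⟨hx.1, hx.2.trans hT.2⟩
            refine (hwcont.mono ?_).intervalIntegrable
            rw [Set.uIcc_of_le hT.1]
            exact Set.Icc_subset_Ici_self
        _ = T * w s := by simp
        _ ≤ t * w s := by gcongr; exact hT.2
    have hsq := le_mul_exp_of_le_add_mul_integral (u := fun x => w x ^ 2) (K := 2 * lam)
      (ε := 2 * c * (t * w s)) (b := t) (by positivity) (hwcont.pow 2)
      (fun x _ => sq_nonneg _) (fun T hT => by
        have := hineq T hT.1
        have := mul_le_mul_of_nonneg_left (hint T hT) hc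
        linarith) s hs
    refine (hM t ⟨ht, le_rfl⟩).trans ?_
    rcases hM0.eq_or_lt with h0 | hpos
    · rw [← h0]
      positivity
    · refine le_of_mul_le_mul_right ?_ hpos
      calc w s * w s = w s ^ 2 := (sq _).symm
        _ ≤ 2 * c * (t * w s) * Real.exp (2 * lam * s) := hsq
        _ ≤ 2 * c * (t * w s) * Real.exp (2 * lam * t) := by gcongr; exact hs.2
        _ = 2 * c * t * Real.exp (2 * lam * t) * w s := by ring
  refine ⟨main, fun t ht => (main t ht.1).trans ?_⟩
  have ht0 := ht.1
  calc 2 * c * t * Real.exp (2 * lam * t) ≤ 2 * c * t * Real.exp (2 * lam * 1) := by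
        gcongr
        exact ht.2
    _ = 2 * Real.exp (2 * lam) * c * t := by rw [mul_one]; ring
end

section
/- Let X be a metric space, λ > 0, and S(t) : X → X, t ≥ 0, a semigroup of maps satisfying d(S(t)x, S(t)y) ≤ e^{λt} d(x,y) for all t ≥ 0 and x,y ∈ X. Suppose S has a global attractor Θ, i.e. Θ ⊆ X is nonempty compact, S(t)Θ = Θ for all t ≥ 0, and sup_{x∈B} dist(S(t)x, Θ) → 0 as t → ∞ for every bounded B ⊆ X. Then Θ is uniformly globally asymptotically stable for S: there exists β₀ ∈ 𝒦ℒ such that dist(S(t)x, Θ) ≤ β₀(dist(x,Θ), t) for all x ∈ X and t ≥ 0. -/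
/-- A comparison function of class 𝒦: continuous and strictly increasing on [0,∞) with γ(0)=0. -/
def IsKFun (γ : ℝ → ℝ) : Prop :=
  ContinuousOn γ (Set.Ici 0) ∧ StrictMonoOn γ (Set.Ici 0) ∧ γ 0 = 0

/-- A comparison function of class 𝒦ℒ: continuous on [0,∞)×[0,∞), of class 𝒦 in the first
argument for each fixed t ≥ 0, and strictly decreasing to 0 in the second argument for each
fixed s > 0. -/
def IsKLFun (β : ℝ → ℝ → ℝ) : Prop :=
  ContinuousOn (fun p : ℝ × ℝ => β p.1 p.2) (Set.Ici 0 ×ˢ Set.Ici 0) ∧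
  (∀ t : ℝ, 0 ≤ t → IsKFun fun s => β s t) ∧
  (∀ s : ℝ, 0 < s → StrictAntiOn (β s) (Set.Ici 0) ∧
    Filter.Tendsto (β s) Filter.atTop (nhds 0))

open Set Filter Topology in
/-- A nonnegative monotone function that is small near `0` is dominated by a class 𝒦 function. -/
theorem exists_isKFun_ge {W : ℝ → ℝ} (hW : Monotone W) (hpos : ∀ u, 0 ≤ W u)
    (hsmall : ∀ ε > 0, ∃ δ > 0, W δ ≤ ε) :
    ∃ α : ℝ → ℝ, IsKFun α ∧ ∀ u, 0 ≤ u → W u ≤ α u := by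
  have hW0 : W 0 = 0 := by
    refine le_antisymm (le_of_forall_pos_le_add fun ε hε => ?_) (hpos 0)
    obtain ⟨δ, hδ, h⟩ := hsmall ε hε
    have := hW hδ.le
    linarith
  have hint : ∀ a b, IntervalIntegrable W MeasureTheory.volume a b :=
    fun a b => hW.intervalIntegrable
  have hint' : ∀ u, 0 ≤ u →
      IntervalIntegrable (fun v => W (u * v)) MeasureTheory.volume 1 2 := fun u hu =>
    Monotone.intervalIntegrable fun a b hab => hW (mul_le_mul_of_nonneg_left hab hu)
  have hlow : ∀ u, 0 ≤ u → W u ≤ ∫ v in (1 : ℝ)..2, W (u * v) := fun u hu => by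
    have h := intervalIntegral.integral_mono_on (by norm_num : (1 : ℝ) ≤ 2)
      (intervalIntegrable_const (c := W u)) (hint' u hu)
      (fun v hv => hW (by nlinarith [hv.1]))
    norm_num at h
    exact h
  have hupp : ∀ u, 0 ≤ u → ∫ v in (1 : ℝ)..2, W (u * v) ≤ W (2 * u) := fun u hu => by
    have h := intervalIntegral.integral_mono_on (by norm_num : (1 : ℝ) ≤ 2)
      (hint' u hu) (intervalIntegrable_const (c := W (2 * u)))
      (fun v hv => hW (by nlinarith [hv.2]))
    norm_num at h
    exact h
  have hmono : ∀ a b, 0 ≤ a → a ≤ b →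
      ∫ v in (1 : ℝ)..2, W (a * v) ≤ ∫ v in (1 : ℝ)..2, W (b * v) := fun a b ha hab =>
    intervalIntegral.integral_mono_on (by norm_num) (hint' a ha) (hint' b (ha.trans hab))
      (fun v hv => hW (mul_le_mul_of_nonneg_right hab (by linarith [hv.1])))
  have hcont : ContinuousOn (fun u => ∫ v in (1 : ℝ)..2, W (u * v)) (Ici 0) := by
    intro u hu
    rcases (mem_Ici.1 hu).eq_or_lt with rfl | hu
    · rw [Metric.continuousWithinAt_iff]
      intro ε hε
      obtain ⟨δ, hδ, h⟩ := hsmall (ε / 2) (by positivity)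
      refine ⟨δ / 2, by positivity, fun {x} hx hxd => ?_⟩
      have hx0 : 0 ≤ x := hx
      rw [Real.dist_eq, sub_zero, abs_of_nonneg hx0] at hxd
      have h1 := hupp x hx0
      have h2 : W (2 * x) ≤ W δ := hW (by linarith)
      have h3 := (hpos x).trans (hlow x hx0)
      simp only [zero_mul, hW0, intervalIntegral.integral_zero, Real.dist_eq, sub_zero]
      rw [abs_of_nonneg h3]
      linarith
    · have hF : Continuous fun u => ∫ v in (0 : ℝ)..u, W v :=
        intervalIntegral.continuous_primitive hint 0
      have hG : ContinuousAt
          (fun u : ℝ => u⁻¹ * ((∫ v in (0 : ℝ)..(u * 2), W v) - ∫ v in (0 : ℝ)..u, W v)) u := by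
        refine (continuousAt_inv₀ hu.ne').mul (Continuous.continuousAt ?_)
        exact (hF.comp (continuous_id.mul continuous_const)).sub hF
      refine (hG.congr ?_).continuousWithinAt
      filter_upwards [eventually_ne_nhds hu.ne'] with x hx
      rw [intervalIntegral.integral_comp_mul_left W hx, mul_one, smul_eq_mul,
        intervalIntegral.integral_interval_sub_left (hint _ _) (hint _ _)]
  refine ⟨fun u => u + ∫ v in (1 : ℝ)..2, W (u * v),
    ⟨continuousOn_id.add hcont, fun a ha b _ hab => ?_, ?_⟩, fun u hu => ?_⟩
  · exact add_lt_add_of_lt_of_le hab (hmono a b ha hab.le)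
  · simp [hW0]
  · exact (hlow u hu).trans (by linarith)

theorem IsKFun.nonneg {γ : ℝ → ℝ} (hγ : IsKFun γ) {s : ℝ} (hs : 0 ≤ s) : 0 ≤ γ s := by
  have := hγ.2.1.monotoneOn (Set.mem_Ici.2 le_rfl) (Set.mem_Ici.2 hs) hs
  rwa [hγ.2.2] at this

theorem IsKFun.pos {γ : ℝ → ℝ} (hγ : IsKFun γ) {s : ℝ} (hs : 0 < s) : 0 < γ s := by
  have := hγ.2.1 (Set.mem_Ici.2 le_rfl) (Set.mem_Ici.2 hs.le) hs
  rwa [hγ.2.2] at this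

open Set Filter Topology in
theorem IsKFun.isKLFun_comp_mul_exp {α ρ : ℝ → ℝ} (hα : IsKFun α) (hρ : IsKFun ρ) :
    IsKLFun fun s t => α (ρ s * Real.exp (-t)) := by
  have hmaps : ∀ s t, 0 ≤ s → ρ s * Real.exp (-t) ∈ Ici (0 : ℝ) := fun s t hs =>
    mul_nonneg (hρ.nonneg hs) (Real.exp_pos _).le
  have hcont : ContinuousOn (fun p : ℝ × ℝ => α (ρ p.1 * Real.exp (-p.2)))
      (Ici 0 ×ˢ Ici 0) := by
    refine hα.1.comp (t := Ici 0) (ContinuousOn.mul ?_ ?_) fun p hp => hmaps _ _ hp.1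
    · exact hρ.1.comp continuousOn_fst fun p hp => hp.1
    · exact (Real.continuous_exp.comp continuous_snd.neg).continuousOn
  refine ⟨hcont, fun t ht => ⟨?_, fun a ha b hb hab => ?_, ?_⟩, fun s hs => ⟨?_, ?_⟩⟩
  · exact hcont.comp (f := fun s : ℝ => (s, t)) (by fun_prop) fun s hs => ⟨hs, ht⟩
  · exact hα.2.1 (hmaps _ _ ha) (hmaps _ _ hb)
      (mul_lt_mul_of_pos_right (hρ.2.1 ha hb hab) (Real.exp_pos _))
  · simp [hρ.2.2, hα.2.2]
  · intro a _ b _ hab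
    exact hα.2.1 (hmaps _ _ hs.le) (hmaps _ _ hs.le)
      (mul_lt_mul_of_pos_left (Real.exp_lt_exp.2 (by linarith)) (hρ.pos hs))
  · have h1 : Tendsto α (𝓝[Ici 0] 0) (𝓝 0) := by
      have := hα.1 0 (mem_Ici.2 le_rfl)
      rwa [ContinuousWithinAt, hα.2.2] at this
    refine h1.comp (tendsto_nhdsWithin_iff.2 ⟨?_, Eventually.of_forall fun t => hmaps _ _ hs.le⟩)
    simpa using (Real.tendsto_exp_neg_atTop_nhds_zero).const_mul (ρ s)

theorem Metric.isBounded_setOf_infDist_le {X : Type*} [MetricSpace X] {Θ : Set X}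
    (hne : Θ.Nonempty) (hcomp : IsCompact Θ) (R : ℝ) :
    Bornology.IsBounded {x | Metric.infDist x Θ ≤ R} := by
  refine (hcomp.isBounded.cthickening (δ := R)).subset fun x hx => ?_
  obtain ⟨y, hy, h⟩ := hcomp.exists_infDist_eq_dist hne x
  exact Metric.mem_cthickening_of_dist_le x y R Θ hy (h ▸ hx)

/-- A doubly indexed family is dominated by the sum of a monotone nonnegative sequence evaluated
at each of the two indices. -/
theorem exists_monotone_add_ge (T : ℕ → ℕ → ℝ) :
    ∃ A : ℕ → ℝ, Monotone A ∧ (∀ n, 0 ≤ A n) ∧ ∀ n m, T n m ≤ A n + A m := by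
  let A : ℕ → ℝ := fun n => ∑ p ∈ Finset.range (n + 1) ×ˢ Finset.range (n + 1), |T p.1 p.2|
  have hA0 : ∀ n, 0 ≤ A n := fun n => Finset.sum_nonneg fun _ _ => abs_nonneg _
  have hle : ∀ n m k, n ≤ k → m ≤ k → T n m ≤ A k := fun n m k hn hm =>
    (le_abs_self _).trans <| Finset.single_le_sum (f := fun p : ℕ × ℕ => |T p.1 p.2|)
      (fun _ _ => abs_nonneg _) (a := (n, m))
      (by simp only [Finset.mem_product, Finset.mem_range]; omega)
  refine ⟨A, fun n m h => ?_, hA0, fun n m => ?_⟩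
  · refine Finset.sum_le_sum_of_subset_of_nonneg (fun p hp => ?_) fun _ _ _ => abs_nonneg _
    simp only [Finset.mem_product, Finset.mem_range] at hp ⊢
    omega
  · rcases le_total n m with h | h
    · linarith [hle n m m h le_rfl, hA0 n]
    · linarith [hle n m n le_rfl h, hA0 m]

/-- Let X be a metric space, λ > 0, and S(t) : X → X, t ≥ 0, a semigroup of maps
satisfying d(S(t)x, S(t)y) ≤ e^{λt} d(x,y). Suppose S has a global attractor Θ (nonempty,
compact, invariant, uniformly attracting bounded sets). Then Θ is uniformly globally
asymptotically stable for S: there exists β₀ ∈ 𝒦ℒ such that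
dist(S(t)x, Θ) ≤ β₀(dist(x,Θ), t) for all x ∈ X and t ≥ 0. -/
theorem stmt8 {X : Type*} [MetricSpace X] (lam : ℝ) (hlam : 0 < lam)
    (S : ℝ → X → X)
    (hS0 : ∀ x, S 0 x = x)
    (hSadd : ∀ t s : ℝ, 0 ≤ t → 0 ≤ s → ∀ x, S (t + s) x = S t (S s x))
    (hLip : ∀ t : ℝ, 0 ≤ t → ∀ x y : X, dist (S t x) (S t y) ≤ Real.exp (lam * t) * dist x y)
    (Θ : Set X) (hne : Θ.Nonempty) (hcomp : IsCompact Θ)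
    (hinv : ∀ t : ℝ, 0 ≤ t → S t '' Θ = Θ)
    (hattr : ∀ B : Set X, Bornology.IsBounded B → ∀ ε : ℝ, 0 < ε →
      ∃ T : ℝ, ∀ t : ℝ, T ≤ t → ∀ x ∈ B, Metric.infDist (S t x) Θ < ε) :
    ∃ β₀ : ℝ → ℝ → ℝ, IsKLFun β₀ ∧
      ∀ x : X, ∀ t : ℝ, 0 ≤ t → Metric.infDist (S t x) Θ ≤ β₀ (Metric.infDist x Θ) t := by
  choose T hT using fun n m : ℕ => hattr _
    (Metric.isBounded_setOf_infDist_le hne hcomp (n : ℝ)) (1 / ((m : ℝ) + 1)) (by positivity)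
  obtain ⟨A, hAmono, hA0, hTA⟩ := exists_monotone_add_ge T
  have hgrow : ∀ t : ℝ, 0 ≤ t → ∀ x,
      Metric.infDist (S t x) Θ ≤ Real.exp (lam * t) * Metric.infDist x Θ := by
    intro t ht x
    obtain ⟨y, hy, h⟩ := hcomp.exists_infDist_eq_dist hne x
    rw [h]
    exact (Metric.infDist_le_dist_of_mem (hinv t ht ▸ Set.mem_image_of_mem _ hy)).trans
      (hLip t ht x y)
  have hceil : Monotone fun r : ℝ => A ⌈r⌉₊ := hAmono.comp Nat.ceil_mono
  obtain ⟨ρ, hρ, hρge⟩ := exists_isKFun_ge (W := fun r => max r 0 * Real.exp (A ⌈r⌉₊))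
    (Monotone.mul (monotone_id.max monotone_const) (Real.exp_monotone.comp hceil)
      (fun r => le_max_right _ _) fun r => (Real.exp_pos _).le)
    (fun r => by positivity)
    (fun ε hε => by
      refine ⟨min 1 (ε / Real.exp (A 1)), by positivity, ?_⟩
      have hδ : 0 < min 1 (ε / Real.exp (A 1)) := by positivity
      have hc : ⌈min 1 (ε / Real.exp (A 1))⌉₊ ≤ 1 := Nat.ceil_le.2 (by simp)
      rw [max_eq_left hδ.le]
      calc _ ≤ ε / Real.exp (A 1) * Real.exp (A 1) :=
            mul_le_mul (min_le_right _ _) (Real.exp_le_exp.2 (hAmono hc))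
              (Real.exp_pos _).le (by positivity)
        _ = ε := div_mul_cancel₀ _ (Real.exp_pos _).ne')
  let F : ℕ → ℝ → ℝ := fun m u =>
    Real.exp (lam * (A ⌈u * Real.exp (A m)⌉₊ + A m)) * (u * Real.exp (A m))
  have hbound : ∀ (m : ℕ) x t u, 0 ≤ t → ρ (Metric.infDist x Θ) * Real.exp (-t) ≤ u →
      Metric.infDist (S t x) Θ ≤ max (1 / ((m : ℝ) + 1)) (F m u) := by
    intro m x t u ht hu
    set r := Metric.infDist x Θ
    have hr0 : 0 ≤ r := Metric.infDist_nonneg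
    rcases le_or_gt (A ⌈r⌉₊ + A m) t with h | h
    · exact le_max_of_le_left (hT ⌈r⌉₊ m t ((hTA _ _).trans h) x (Nat.le_ceil r)).le
    · have hru : r ≤ u * Real.exp (A m) := by
        have h1 := hρge r hr0
        simp only [max_eq_left hr0] at h1
        have h2 : r * Real.exp (-A m) ≤ u := by
          calc r * Real.exp (-A m) ≤ r * Real.exp (A ⌈r⌉₊ - t) :=
                mul_le_mul_of_nonneg_left (Real.exp_le_exp.2 (by linarith)) hr0
            _ = r * Real.exp (A ⌈r⌉₊) * Real.exp (-t) := by
                rw [mul_assoc, ← Real.exp_add, sub_eq_add_neg]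
            _ ≤ ρ r * Real.exp (-t) := mul_le_mul_of_nonneg_right h1 (Real.exp_pos _).le
            _ ≤ u := hu
        rwa [Real.exp_neg, ← div_eq_mul_inv, div_le_iff₀ (Real.exp_pos _)] at h2
      refine le_max_of_le_right ((hgrow t ht x).trans (mul_le_mul ?_ hru hr0 (Real.exp_pos _).le))
      have h3 : A ⌈r⌉₊ ≤ A ⌈u * Real.exp (A m)⌉₊ := hceil hru
      exact Real.exp_le_exp.2 (mul_le_mul_of_nonneg_left (by linarith) hlam.le)
  let V : ℝ → Set ℝ := fun u => {g | ∃ x t, 0 ≤ t ∧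
    ρ (Metric.infDist x Θ) * Real.exp (-t) ≤ u ∧ Metric.infDist (S t x) Θ = g}
  have hVub : ∀ (m : ℕ) u, ∀ g ∈ V u, g ≤ max (1 / ((m : ℝ) + 1)) (F m u) := by
    rintro m u g ⟨x, t, ht, hu, rfl⟩
    exact hbound m x t u ht hu
  have hVbdd : ∀ u, BddAbove (V u) := fun u => ⟨_, hVub 0 u⟩
  have hVnonneg : ∀ u, 0 ≤ sSup (V u) := fun u => Real.sSup_nonneg (by
    rintro g ⟨x, t, _, _, rfl⟩
    exact Metric.infDist_nonneg)
  obtain ⟨α, hα, hαge⟩ := exists_isKFun_ge (W := fun u => sSup (V u))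
    (fun a b hab => Real.sSup_le (by
      rintro g ⟨x, t, ht, hu, rfl⟩
      exact le_csSup (hVbdd b) ⟨x, t, ht, hu.trans hab, rfl⟩) (hVnonneg b))
    hVnonneg
    (fun ε hε => by
      obtain ⟨m, hm⟩ := exists_nat_one_div_lt hε
      set C := Real.exp (lam * (A 1 + A m))
      have hCpos : 0 < C := Real.exp_pos _
      set δ := min 1 (ε / C) / Real.exp (A m)
      have hδpos : 0 < δ := by positivity
      have hδm : δ * Real.exp (A m) = min 1 (ε / C) := div_mul_cancel₀ _ (Real.exp_pos _).ne'
      refine ⟨δ, hδpos, Real.sSup_le (fun g hg => (hVub m δ g hg).trans (max_le hm.le ?_)) hε.le⟩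
      have hc : A ⌈min 1 (ε / C)⌉₊ ≤ A 1 := hAmono (Nat.ceil_le.2 (by simp))
      simp only [F, hδm]
      calc _ ≤ C * (ε / C) :=
            mul_le_mul (Real.exp_le_exp.2 (mul_le_mul_of_nonneg_left (by linarith) hlam.le))
              (min_le_right _ _) (by positivity) hCpos.le
        _ = ε := mul_div_cancel₀ _ hCpos.ne')
  refine ⟨_, hα.isKLFun_comp_mul_exp hρ, fun x t ht => ?_⟩
  exact (le_csSup (hVbdd _) ⟨x, t, ht, le_rfl, rfl⟩).trans
    (hαge _ (mul_nonneg (hρ.nonneg Metric.infDist_nonneg) (Real.exp_pos _).le))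
end

section
/- Let X be a normed space, λ, c₀, ε > 0, T ≥ 0, and Θ ⊆ X nonempty compact. Let S(t) : X → X, t ≥ 0, be a semigroup of maps with S(t)Θ = Θ and ‖S(t)x − S(t)y‖ ≤ e^{λt}‖x − y‖ for all t ≥ 0 and x,y ∈ X. Define V^ε(x) := e^{−(λ+c₀)T} · sup_{t∈[0,T]} ( e^{c₀ t} · max{0, dist(S(t)x, Θ) − ε} ) for x ∈ X. Then V^ε is well-defined (the supremum is finite) and |V^ε(x) − V^ε(y)| ≤ ‖x − y‖ for all x, y ∈ X. -/
/-- Let X be a normed space, λ, c₀, ε > 0, T ≥ 0, and Θ ⊆ X nonempty compact.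
Let S(t) : X → X, t ≥ 0, be a semigroup of maps with S(t)Θ = Θ and
‖S(t)x − S(t)y‖ ≤ e^{λt}‖x − y‖ for all t ≥ 0 and x,y ∈ X. Define
V^ε(x) := e^{−(λ+c₀)T} · sup_{t∈[0,T]} ( e^{c₀ t} · max{0, dist(S(t)x, Θ) − ε} ) for x ∈ X.
Then V^ε is well-defined (the supremum is finite) and |V^ε(x) − V^ε(y)| ≤ ‖x − y‖
for all x, y ∈ X. -/
theorem stmt10 {X : Type*} [NormedAddCommGroup X] [NormedSpace ℝ X]
    (lam c₀ ε T : ℝ) (hlam : 0 < lam) (hc₀ : 0 < c₀) (hε : 0 < ε) (hT : 0 ≤ T)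
    (Θ : Set X) (hne : Θ.Nonempty) (hcomp : IsCompact Θ)
    (S : ℝ → X → X)
    (hS0 : ∀ x, S 0 x = x)
    (hSadd : ∀ t s : ℝ, 0 ≤ t → 0 ≤ s → ∀ x, S (t + s) x = S t (S s x))
    (hinv : ∀ t : ℝ, 0 ≤ t → S t '' Θ = Θ)
    (hLip : ∀ t : ℝ, 0 ≤ t → ∀ x y : X, ‖S t x - S t y‖ ≤ Real.exp (lam * t) * ‖x - y‖)
    (V : X → ℝ)
    (hV : ∀ x : X, V x = Real.exp (-(lam + c₀) * T) *
      sSup ((fun t => Real.exp (c₀ * t) * max 0 (Metric.infDist (S t x) Θ - ε)) '' Set.Icc 0 T)) :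
    (∀ x : X, BddAbove
      ((fun t => Real.exp (c₀ * t) * max 0 (Metric.infDist (S t x) Θ - ε)) '' Set.Icc 0 T)) ∧
    ∀ x y : X, |V x - V y| ≤ ‖x - y‖ := by
  set f : X → ℝ → ℝ :=
    fun x t => Real.exp (c₀ * t) * max 0 (Metric.infDist (S t x) Θ - ε) with hf
  have key : ∀ x y : X, ∀ t ∈ Set.Icc 0 T,
      f x t ≤ f y t + Real.exp ((lam + c₀) * T) * ‖x - y‖ := by
    rintro x y t ⟨ht0, htT⟩
    have hdist : Metric.infDist (S t x) Θ ≤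
        Metric.infDist (S t y) Θ + Real.exp (lam * t) * ‖x - y‖ := by
      have h := Metric.infDist_le_infDist_add_dist (s := Θ) (x := S t x) (y := S t y)
      rw [dist_eq_norm] at h
      linarith [hLip t ht0 x y]
    have hmax : max 0 (Metric.infDist (S t x) Θ - ε) ≤
        max 0 (Metric.infDist (S t y) Θ - ε) + Real.exp (lam * t) * ‖x - y‖ := by
      have hnonneg : 0 ≤ Real.exp (lam * t) * ‖x - y‖ := by positivity
      apply max_le
      · linarith [le_max_left 0 (Metric.infDist (S t y) Θ - ε)]
      · linarith [le_max_right 0 (Metric.infDist (S t y) Θ - ε)]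
    calc f x t ≤ Real.exp (c₀ * t) *
          (max 0 (Metric.infDist (S t y) Θ - ε) + Real.exp (lam * t) * ‖x - y‖) :=
          mul_le_mul_of_nonneg_left hmax (Real.exp_nonneg _)
      _ = f y t + Real.exp ((lam + c₀) * t) * ‖x - y‖ := by
          rw [add_mul lam, Real.exp_add]
          simp only [hf]
          ring
      _ ≤ f y t + Real.exp ((lam + c₀) * T) * ‖x - y‖ := by gcongr
  have hbdd : ∀ x : X, BddAbove (f x '' Set.Icc 0 T) := by
    intro x
    obtain ⟨θ, hθ⟩ := hne
    refine ⟨Real.exp ((lam + c₀) * T) * ‖x - θ‖, ?_⟩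
    rintro _ ⟨t, ht, rfl⟩
    have hmem : S t θ ∈ Θ := hinv t ht.1 ▸ Set.mem_image_of_mem (S t) hθ
    have hzero : f θ t = 0 := by
      simp [hf, Metric.infDist_zero_of_mem hmem, hε.le]
    linarith [key x θ t ht]
  have hle : ∀ x y : X, V x - V y ≤ ‖x - y‖ := by
    intro x y
    have hsup : sSup (f x '' Set.Icc 0 T) ≤
        sSup (f y '' Set.Icc 0 T) + Real.exp ((lam + c₀) * T) * ‖x - y‖ := by
      apply csSup_le ((Set.nonempty_Icc.2 hT).image _)
      rintro _ ⟨t, ht, rfl⟩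
      linarith [key x y t ht, le_csSup (hbdd y) (Set.mem_image_of_mem (f y) ht)]
    have hexp : Real.exp (-(lam + c₀) * T) * Real.exp ((lam + c₀) * T) = 1 := by
      rw [← Real.exp_add, neg_mul, neg_add_cancel, Real.exp_zero]
    have hmul := mul_le_mul_of_nonneg_left hsup (Real.exp_nonneg (-(lam + c₀) * T))
    rw [mul_add, ← mul_assoc, hexp, one_mul, ← hV x, ← hV y] at hmul
    linarith
  refine ⟨hbdd, fun x y => abs_le.2 ⟨?_, hle x y⟩⟩
  linarith [hle y x, norm_sub_rev x y]
end

section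
/- Let X be a normed space, Θ ⊆ X nonempty compact, r₀ > 0, λ, K > 0, and α ∈ 𝒦∞. Let V : {x ∈ X : dist(x,Θ) ≤ r₀} → [0,∞) satisfy |V(x) − V(y)| ≤ ‖x − y‖ on its domain. Let S₀(t) : X → X, t ≥ 0, be maps with dist(S₀(t)x, Θ) ≤ e^{λt} dist(x,Θ) for all t,x, and suppose limsup_{t→0+} ( V(S₀(t)x) − V(x) )/t ≤ −α(dist(x,Θ)) for all x with dist(x,Θ) < r₀. Let 𝒰 denote the set of bounded functions u : [0,∞) → ℝ, with ‖u‖∞ := sup_{t≥0}|u(t)|, and for each u ∈ 𝒰 let S_u(t) : X → X, t ≥ 0, be maps with ‖S_u(t)x − S₀(t)x‖ ≤ K·‖u‖∞·t for all x ∈ X and t ∈ [0,1]. Then for every u ∈ 𝒰 and every x with dist(x,Θ) < r₀: limsup_{t→0+} ( V(S_u(t)x) − V(x) )/t ≤ −α(dist(x,Θ)) + K·‖u‖∞ (note that dist(S_u(t)x, Θ) ≤ e^{λt} dist(x,Θ) + K‖u‖∞ t < r₀ for small t > 0, so V(S_u(t)x) is defined). -/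
/-- Class 𝒦∞: a 𝒦 function that is unbounded. -/
def IsKInfFun (γ : ℝ → ℝ) : Prop :=
  IsKFun γ ∧ Filter.Tendsto γ Filter.atTop Filter.atTop

/-- Real-valued upper limits of functions at eventual distance at most `c` differ by at most `c`.
No boundedness is needed: the two functions are bounded or unbounded simultaneously. -/
theorem limsup_le_limsup_add_of_abs_sub_le {ι : Type*} {l : Filter ι} {f g : ι → ℝ} {c : ℝ}
    (hc : 0 ≤ c) (h : ∀ᶠ t in l, |f t - g t| ≤ c) :
    Filter.limsup f l ≤ Filter.limsup g l + c := by
  have hfg : ∀ a, (∀ᶠ t in l, g t ≤ a) → ∀ᶠ t in l, f t ≤ a + c := by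
    intro a ha
    filter_upwards [ha, h] with t h1 h2
    linarith [(abs_le.mp h2).2]
  have hgf : ∀ a, (∀ᶠ t in l, f t ≤ a) → ∀ᶠ t in l, g t ≤ a + c := by
    intro a ha
    filter_upwards [ha, h] with t h1 h2
    linarith [(abs_le.mp h2).1]
  rw [Filter.limsup_eq, Filter.limsup_eq]
  by_cases hne : {a | ∀ᶠ t in l, g t ≤ a}.Nonempty
  · by_cases hbd : BddBelow {a | ∀ᶠ t in l, f t ≤ a}
    · rw [← sub_le_iff_le_add]
      refine le_csInf hne fun a ha => ?_
      linarith [csInf_le hbd (hfg a ha)]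
    · have hbd' : ¬ BddBelow {a | ∀ᶠ t in l, g t ≤ a} := by
        rintro ⟨b, hb⟩
        refine hbd ⟨b - c, fun a ha => ?_⟩
        linarith [hb (hgf a ha)]
      rw [Real.sInf_of_not_bddBelow hbd, Real.sInf_of_not_bddBelow hbd']
      linarith
  · have hne' : ¬ {a | ∀ᶠ t in l, f t ≤ a}.Nonempty :=
      fun ⟨a, ha⟩ => hne ⟨a + c, hgf a ha⟩
    rw [Set.not_nonempty_iff_eq_empty] at hne hne'
    rw [hne, hne', Real.sInf_empty]
    linarith

/-- Lemma 3.2, abstract form: Let X be a normed space, Θ ⊆ X nonempty compact,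
r₀ > 0, λ, K > 0, and α ∈ 𝒦∞. Let V be 1-Lipschitz on the ball {dist(·,Θ) ≤ r₀} with values
in [0,∞). Let S₀(t) satisfy dist(S₀(t)x, Θ) ≤ e^{λt} dist(x,Θ) and the Lyapunov decay
limsup_{t→0+} (V(S₀(t)x) − V(x))/t ≤ −α(dist(x,Θ)) for dist(x,Θ) < r₀. Let u : [0,∞) → ℝ be
bounded with sup-norm ‖u‖∞, and let S_u(t) satisfy ‖S_u(t)x − S₀(t)x‖ ≤ K‖u‖∞ t for t ∈ [0,1].
Then for every x with dist(x,Θ) < r₀: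
limsup_{t→0+} (V(S_u(t)x) − V(x))/t ≤ −α(dist(x,Θ)) + K‖u‖∞. -/
theorem stmt14 {X : Type*} [NormedAddCommGroup X] [NormedSpace ℝ X]
    (Θ : Set X) (hne : Θ.Nonempty) (hcomp : IsCompact Θ)
    (r₀ lam K : ℝ) (hr₀ : 0 < r₀) (hlam : 0 < lam) (hK : 0 < K)
    (α : ℝ → ℝ) (hα : IsKInfFun α)
    (V : X → ℝ)
    (hVnn : ∀ x : X, Metric.infDist x Θ ≤ r₀ → 0 ≤ V x)
    (hVlip : ∀ x y : X, Metric.infDist x Θ ≤ r₀ → Metric.infDist y Θ ≤ r₀ →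
      |V x - V y| ≤ ‖x - y‖)
    (S₀ : ℝ → X → X)
    (hS₀dist : ∀ t : ℝ, 0 ≤ t → ∀ x : X,
      Metric.infDist (S₀ t x) Θ ≤ Real.exp (lam * t) * Metric.infDist x Θ)
    (hV₀decay : ∀ x : X, Metric.infDist x Θ < r₀ →
      Filter.limsup (fun t => (V (S₀ t x) - V x) / t) (nhdsWithin 0 (Set.Ioi 0)) ≤
        -α (Metric.infDist x Θ))
    (u : ℝ → ℝ) (hu : BddAbove ((fun t => |u t|) '' Set.Ici 0))
    (uN : ℝ) (huN : uN = sSup ((fun t => |u t|) '' Set.Ici 0))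
    (Su : ℝ → X → X)
    (hSu : ∀ x : X, ∀ t ∈ Set.Icc (0:ℝ) 1, ‖Su t x - S₀ t x‖ ≤ K * uN * t) :
    ∀ x : X, Metric.infDist x Θ < r₀ →
      Filter.limsup (fun t => (V (Su t x) - V x) / t) (nhdsWithin 0 (Set.Ioi 0)) ≤
        -α (Metric.infDist x Θ) + K * uN := by
  intro x hx
  have huN0 : 0 ≤ uN := by
    rw [huN]
    apply Real.sSup_nonneg
    rintro _ ⟨t, -, rfl⟩
    exact abs_nonneg _
  refine (limsup_le_limsup_add_of_abs_sub_le (mul_nonneg hK.le huN0) ?_).trans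
    (add_le_add_left (hV₀decay x hx) _)
  have hcont : ContinuousAt
      (fun t : ℝ => Real.exp (lam * t) * Metric.infDist x Θ + K * uN * t) 0 := by
    fun_prop
  have hsmall : ∀ᶠ t in nhdsWithin (0 : ℝ) (Set.Ioi 0),
      Real.exp (lam * t) * Metric.infDist x Θ + K * uN * t < r₀ :=
    nhdsWithin_le_nhds (hcont.eventually_lt_const (by simpa using hx))
  filter_upwards [hsmall, Ioc_mem_nhdsGT (zero_lt_one' ℝ)] with t ht ⟨ht0, ht1⟩
  have hclose := hSu x t ⟨ht0.le, ht1⟩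
  have hS₀ := hS₀dist t ht0.le x
  have hdist : Metric.infDist (Su t x) Θ ≤ Metric.infDist (S₀ t x) Θ + ‖Su t x - S₀ t x‖ := by
    rw [← dist_eq_norm]
    exact Metric.infDist_le_infDist_add_dist
  have hpos : 0 ≤ K * uN * t := by positivity
  have hV := hVlip (Su t x) (S₀ t x) (by linarith) (by linarith)
  rw [← sub_div, sub_sub_sub_cancel_right, abs_div, abs_of_pos ht0, div_le_iff₀ ht0]
  exact hV.trans hclose
end
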